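/- Let G be a perfect finite simple graph on vertices x_1,…,x_n with no isolated vertices. Then the symbolic Rees algebra of the edge ideal I(G) is R_s(I(G)) = K[ x^a t^r : x^a a square-free monomial whose support is a clique of G with r+1 vertices, 0 ≤ r < n ], as subalgebras of R[t]. -/

import Mathlib

open Finset

/-- A vertex cover of a graph: a set of vertices meeting every edge. -/
def IsVCover {n : ℕ} (G : SimpleGraph (Fin n)) (C : Finset (Fin n)) : Prop :=
  ∀ ⦃a b : Fin n⦄, G.Adj a b → a ∈ C ∨ b ∈ C

/-- A minimal vertex cover: no proper subset is a vertex cover. -/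
def IsMinVCover {n : ℕ} (G : SimpleGraph (Fin n)) (C : Finset (Fin n)) : Prop :=
  IsVCover G C ∧ ∀ D : Finset (Fin n), D ⊂ C → ¬ IsVCover G D

/-- The clique number of a graph: maximal size of a clique. -/
noncomputable def cliqueNumber {V : Type*} (G : SimpleGraph V) : ℕ :=
  sSup { k : ℕ | ∃ t : Finset V, G.IsNClique k t }

/-- A graph is perfect if for every induced subgraph the chromatic number
equals the clique number. -/
def IsPerfect {V : Type*} (G : SimpleGraph V) : Prop :=
  ∀ s : Set V, (G.induce s).chromaticNumber = (cliqueNumber (G.induce s) : ℕ∞)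

/-- The Rees cone of the ideal of vertex covers `I_c(G)`: all non-negative real
combinations of the unit vectors `e_1,…,e_n` and the vectors `(u_C, 1)` where
`u_C` runs over incidence vectors of minimal vertex covers of `G`. Vectors of
`ℝ^{n+1}` are represented as pairs `(a, a_{n+1}) : (Fin n → ℝ) × ℝ`. -/
def reesCone {n : ℕ} (G : SimpleGraph (Fin n)) : Set ((Fin n → ℝ) × ℝ) :=
  { v | ∃ (c : Fin n → ℝ) (d : Finset (Fin n) → ℝ),
      (∀ i, 0 ≤ c i) ∧ (∀ C, 0 ≤ d C) ∧
      (∀ C, d C ≠ 0 → IsMinVCover G C) ∧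
      (∀ i, v.1 i = c i + ∑ C : Finset (Fin n), d C * (if i ∈ C then 1 else 0)) ∧
      v.2 = ∑ C : Finset (Fin n), d C }


/-- The `i`-th symbolic power of the edge ideal `I(G)`:
`I(G)^{(i)} = 𝔭_1^i ∩ ⋯ ∩ 𝔭_s^i`, where the `𝔭_k` are the minimal primes of
`I(G)`, i.e. the ideals generated by the variables in a minimal vertex cover
`C_k` of `G`. -/
noncomputable def symbolicPower {n : ℕ} (k : Type*) [Field k]
    (G : SimpleGraph (Fin n)) (i : ℕ) : Ideal (MvPolynomial (Fin n) k) :=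
  ⨅ C ∈ { C : Finset (Fin n) | IsMinVCover G C },
    (Ideal.span (MvPolynomial.X '' (C : Set (Fin n)))) ^ i

section WeightedPerfection

variable {V : Type*} {G : SimpleGraph V}

theorem card_inter_le_one_of_isClique_of_isIndepSet [DecidableEq V] {K S : Finset V}
    (hK : G.IsClique (K : Set V)) (hS : G.IsIndepSet (S : Set V)) : #(K ∩ S) ≤ 1 := by
  refine Finset.card_le_one.2 fun a ha b hb => ?_
  rw [Finset.mem_inter] at ha hb
  by_contra hab
  exact hS ha.2 hb.2 hab (hK ha.1 hb.1 hab)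

theorem sum_mul_countP_mem [Fintype V] [DecidableEq V] (T : Multiset (Finset V)) (f : V → ℕ) :
    ∑ v, f v * T.countP (v ∈ ·) = (T.map fun S => ∑ v ∈ S, f v).sum := by
  induction T using Multiset.induction with
  | empty => simp
  | cons S T ih =>
    simp only [Multiset.countP_cons, mul_add, Finset.sum_add_distrib, ih, Multiset.map_cons,
      Multiset.sum_cons]
    rw [add_comm]
    simp

theorem sum_countP_mem [DecidableEq V] (T : Multiset (Finset V)) (K : Finset V) :
    ∑ v ∈ K, T.countP (v ∈ ·) = (T.map fun S => #(K ∩ S)).sum := by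
  induction T using Multiset.induction with
  | empty => simp
  | cons S T ih =>
    simp only [Multiset.countP_cons, Finset.sum_add_distrib, ih, Multiset.map_cons,
      Multiset.sum_cons]
    rw [add_comm]
    simp

theorem IsPerfect.colorable_induce (hG : IsPerfect G) (s : Set V) (m : ℕ)
    (hm : ∀ K : Finset V, (K : Set V) ⊆ s → G.IsClique (K : Set V) → #K ≤ m) :
    (G.induce s).Colorable m := by
  rw [← SimpleGraph.chromaticNumber_le_iff_colorable, hG s, Nat.cast_le]
  refine csSup_le ⟨0, ∅, by simp [SimpleGraph.isNClique_iff]⟩ ?_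
  rintro _ ⟨t, ht, rfl⟩
  rw [← Finset.card_map (Function.Embedding.subtype (· ∈ s))]
  refine hm _ (by intro v; simp +contextual) ?_
  intro a ha b hb hab
  simp only [Finset.coe_map, Function.Embedding.subtype_apply, Set.mem_image] at ha hb
  obtain ⟨a, ha, rfl⟩ := ha
  obtain ⟨b, hb, rfl⟩ := hb
  exact ht ha hb fun h => hab (by rw [h])

/-- In a perfect graph, a vertex weight bounded by `m` on every clique is a sum of the indicators
of `m` independent sets. -/
theorem IsPerfect.exists_indepSets [Fintype V] [DecidableEq V] (hG : IsPerfect G) (w : V → ℕ)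
    (m : ℕ) (hw : ∀ K : Finset V, G.IsClique (K : Set V) → ∑ v ∈ K, w v ≤ m) :
    ∃ T : Multiset (Finset V), T.card = m ∧ (∀ S ∈ T, G.IsIndepSet (S : Set V)) ∧
      ∀ v, T.countP (v ∈ ·) = w v := by
  induction hN : ∑ v, w v using Nat.strong_induction_on generalizing w m with
  | _ N ih =>
  subst hN
  by_cases h : ∃ v, 2 ≤ w v
  · obtain ⟨v, hv⟩ := h
    have hlt : ∑ u, (w u - if u = v then 1 else 0) < ∑ u, w u :=
      Finset.sum_lt_sum (fun u _ => Nat.sub_le _ _) ⟨v, Finset.mem_univ _, by simp; omega⟩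
    obtain ⟨T, hTm, hT, hTw⟩ := ih _ hlt (fun u => w u - if u = v then 1 else 0) m
      (fun K hK => (Finset.sum_le_sum fun u _ => Nat.sub_le _ _).trans (hw K hK)) rfl
    obtain ⟨S, hST, hvS⟩ : ∃ S ∈ T, v ∈ S := by
      rw [← Multiset.countP_pos (p := (v ∈ ·)), hTw v, if_pos rfl]
      omega
    obtain ⟨T, rfl⟩ := Multiset.exists_cons_of_mem hST
    have hwS : ∀ u, w u = (T.countP (u ∈ ·) + if u = v then 1 else 0) + if u ∈ S then 1 else 0 := by
      intro u
      have := hTw u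
      rw [Multiset.countP_cons] at this
      by_cases huv : u = v
      · subst huv; simp only [hvS, if_true] at this ⊢; omega
      · simp only [huv, if_false] at this ⊢; omega
    have hlt' : ∑ u, (T.countP (u ∈ ·) + if u = v then 1 else 0) < ∑ u, w u :=
      Finset.sum_lt_sum (fun u _ => by rw [hwS u]; omega)
        ⟨v, Finset.mem_univ _, by rw [hwS v]; simp [hvS]⟩
    rw [Multiset.card_cons] at hTm
    have hK' : ∀ K : Finset V, G.IsClique (K : Set V) →
        ∑ u ∈ K, (T.countP (u ∈ ·) + if u = v then 1 else 0) ≤ Multiset.card T := by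
      intro K hK
      by_cases hvK : v ∈ K
      · have h1 := hw K hK
        have h2 : 0 < #(K ∩ S) := Finset.card_pos.2 ⟨v, Finset.mem_inter.2 ⟨hvK, hvS⟩⟩
        have h3 : ∑ u ∈ K, (if u ∈ S then 1 else 0) = #(K ∩ S) := by simp
        rw [Finset.sum_congr rfl fun u _ => hwS u, Finset.sum_add_distrib, h3] at h1
        omega
      · rw [Finset.sum_add_distrib, sum_countP_mem, Finset.sum_ite_eq' K v, if_neg hvK, add_zero]
        refine (Multiset.sum_le_card_nsmul _ 1 ?_).trans (by simp)
        intro x hx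
        obtain ⟨S', hS', rfl⟩ := Multiset.mem_map.1 hx
        exact card_inter_le_one_of_isClique_of_isIndepSet hK (hT _ (Multiset.mem_cons_of_mem hS'))
    obtain ⟨T', hTm', hT', hTw'⟩ := ih _ hlt' (fun u => T.countP (u ∈ ·) + if u = v then 1 else 0)
      (Multiset.card T) hK' rfl
    refine ⟨S ::ₘ T', by simp [hTm', hTm], ?_, fun u => ?_⟩
    · intro S' hS'
      rcases Multiset.mem_cons.1 hS' with rfl | hS'
      exacts [hT _ hST, hT' _ hS']
    · rw [Multiset.countP_cons, hTw', hwS u]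
  · push Not at h
    obtain ⟨c⟩ := hG.colorable_induce {v | w v ≠ 0} m fun K hKs hK => by
      refine le_trans ?_ (hw K hK)
      rw [Finset.card_eq_sum_ones]
      exact Finset.sum_le_sum fun v hv => Nat.one_le_iff_ne_zero.2 (hKs hv)
    classical
    refine ⟨Finset.univ.val.map fun j => Finset.univ.filter fun v => ∃ h : w v ≠ 0, c ⟨v, h⟩ = j,
      by simp, ?_, fun v => ?_⟩
    · intro S hS
      obtain ⟨j, -, rfl⟩ := Multiset.mem_map.1 hS
      intro a ha b hb hab hadj
      simp only [Finset.coe_filter, Finset.mem_univ, true_and, Set.mem_ofPred_eq] at ha hb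
      obtain ⟨ha, hca⟩ := ha
      obtain ⟨hb, hcb⟩ := hb
      exact c.valid (v := ⟨a, ha⟩) (w := ⟨b, hb⟩) hadj (hca.trans hcb.symm)
    · rw [Multiset.countP_map]
      by_cases hv : w v = 0
      · simp [hv]
      · have h1 : w v = 1 := by have := h v; omega
        change #(Finset.univ.filter fun j => _) = _
        rw [h1, Finset.card_eq_one]
        refine ⟨c ⟨v, hv⟩, ?_⟩
        ext j
        simp [hv, eq_comm]

/-- In a perfect graph, some clique meets every independent set of maximum weight that avoids the
vertices of weight zero. -/
theorem IsPerfect.exists_isClique_inter_nonempty [Fintype V] [DecidableEq V] (hG : IsPerfect G)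
    (a : V → ℕ) (m : ℕ)
    (ha : ∀ S : Finset V, G.IsIndepSet (S : Set V) → ∑ v ∈ S, a v ≤ m + 1) :
    ∃ K : Finset V, G.IsClique (K : Set V) ∧ ∀ S : Finset V, G.IsIndepSet (S : Set V) →
      (∀ v ∈ S, a v ≠ 0) → ∑ v ∈ S, a v = m + 1 → (K ∩ S).Nonempty := by
  classical
  by_contra! hcon
  choose! S hS _ hSa hKS using hcon
  let Q : Finset (Finset V) := Finset.univ.filter fun K => G.IsClique (K : Set V)
  have hQ : ∀ {K}, K ∈ Q ↔ G.IsClique (K : Set V) := by simp [Q]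
  have hQpos : 0 < #Q := Finset.card_pos.2 ⟨∅, hQ.2 (by simp)⟩
  let F : Multiset (Finset V) := Q.val.map S
  have hF : ∀ K : Finset V, G.IsClique (K : Set V) → ∑ v ∈ K, F.countP (v ∈ ·) ≤ #Q - 1 := by
    intro K hK
    rw [sum_countP_mem, Multiset.map_map]
    change ∑ L ∈ Q, #(K ∩ S L) ≤ _
    rw [← Finset.add_sum_erase _ _ (hQ.2 hK), hKS K hK, Finset.card_empty, zero_add,
      ← Finset.card_erase_of_mem (hQ.2 hK), Finset.card_eq_sum_ones (Q.erase K)]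
    exact Finset.sum_le_sum fun L hL => card_inter_le_one_of_isClique_of_isIndepSet hK
      (hS L (hQ.1 (Finset.mem_of_mem_erase hL)))
  obtain ⟨T, hTm, hT, hTw⟩ := hG.exists_indepSets (fun v => F.countP (v ∈ ·)) (#Q - 1) hF
  have h1 := sum_mul_countP_mem T a
  simp only [hTw] at h1
  rw [sum_mul_countP_mem] at h1
  have h2 : (F.map fun S => ∑ v ∈ S, a v).sum = #Q * (m + 1) := by
    rw [Multiset.map_map]
    change ∑ K ∈ Q, ∑ v ∈ S K, a v = _
    rw [Finset.sum_congr rfl fun K hK => hSa K (hQ.1 hK)]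
    simp
  have h3 : (T.map fun S => ∑ v ∈ S, a v).sum ≤ (#Q - 1) * (m + 1) := by
    refine (Multiset.sum_le_card_nsmul _ (m + 1) ?_).trans (by simp [hTm])
    intro x hx
    obtain ⟨S', hS', rfl⟩ := Multiset.mem_map.1 hx
    exact ha _ (hT _ hS')
  have h4 : (#Q - 1) * (m + 1) < #Q * (m + 1) :=
    Nat.mul_lt_mul_of_pos_right (by omega) (by omega)
  omega

/-- In a perfect graph, a vertex weight bounded by `m` on every independent set is a sum of the
indicators of `m` cliques. -/
theorem IsPerfect.exists_cliques [Fintype V] [DecidableEq V] (hG : IsPerfect G) (a : V → ℕ)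
    (m : ℕ) (ha : ∀ S : Finset V, G.IsIndepSet (S : Set V) → ∑ v ∈ S, a v ≤ m) :
    ∃ T : Multiset (Finset V), T.card = m ∧ (∀ K ∈ T, G.IsClique (K : Set V)) ∧
      ∀ v, T.countP (v ∈ ·) = a v := by
  induction m generalizing a with
  | zero =>
    refine ⟨0, rfl, by simp, fun v => ?_⟩
    have := ha {v} (by simp)
    simp at this
    simp [this]
  | succ m ih =>
    obtain ⟨K, hK, hKS⟩ := hG.exists_isClique_inter_nonempty a m ha
    let L := K.filter (a · ≠ 0)
    have hL : ∀ v, a v = (a v - if v ∈ L then 1 else 0) + if v ∈ L then 1 else 0 := by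
      intro v
      by_cases hv : v ∈ L
      · have := (Finset.mem_filter.1 hv).2
        simp only [hv, if_true]; omega
      · simp [hv]
    have hbound : ∀ S : Finset V, G.IsIndepSet (S : Set V) →
        ∑ v ∈ S, (a v - if v ∈ L then 1 else 0) ≤ m := by
      intro S hS
      have h1 : ∑ v ∈ S, (if v ∈ L then 1 else 0) = #(S ∩ L) := by simp
      have h2 : ∑ v ∈ S, a v = ∑ v ∈ S, (a v - if v ∈ L then 1 else 0) + #(S ∩ L) := by
        rw [← h1, ← Finset.sum_add_distrib]
        exact Finset.sum_congr rfl fun v _ => hL v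
      have h3 := ha S hS
      rcases h3.lt_or_eq with h3 | h3
      · omega
      · have h4 := hKS (S.filter (a · ≠ 0))
          (hS.mono (Finset.coe_subset.2 (Finset.filter_subset _ _))) (by simp)
          (by rw [Finset.sum_filter_ne_zero, h3])
        obtain ⟨v, hv⟩ := h4
        have h5 : 0 < #(S ∩ L) := Finset.card_pos.2 ⟨v, by simp [L] at hv ⊢; tauto⟩
        omega
    obtain ⟨T, hTm, hT, hTa⟩ := ih (fun v => a v - if v ∈ L then 1 else 0) hbound
    refine ⟨L ::ₘ T, by simp [hTm], ?_, fun v => ?_⟩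
    · intro K' hK'
      rcases Multiset.mem_cons.1 hK' with rfl | hK'
      exacts [hK.subset (Finset.coe_subset.2 (Finset.filter_subset _ _)), hT _ hK']
    · rw [Multiset.countP_cons, hTa, ← hL]

end WeightedPerfection

section SymbolicReesAlgebra

variable {n : ℕ} {k : Type*} [Field k] {G : SimpleGraph (Fin n)}

theorem le_sum_of_mem_span_X_image_pow {C : Finset (Fin n)} {i : ℕ} {f : MvPolynomial (Fin n) k}
    (hf : f ∈ Ideal.span (MvPolynomial.X '' (C : Set (Fin n))) ^ i) {m : Fin n →₀ ℕ}
    (hm : m ∈ f.support) : i ≤ ∑ v ∈ C, m v := by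
  induction i generalizing f m with
  | zero => exact Nat.zero_le _
  | succ i ih =>
    rw [pow_succ] at hf
    induction hf using Submodule.mul_induction_on' generalizing m with
    | mem_mul_mem g hg h hh =>
      obtain ⟨a, ha, b, hb, rfl⟩ := Finset.mem_add.1 (MvPolynomial.support_mul g h hm)
      obtain ⟨v, hv, hbv⟩ := MvPolynomial.mem_ideal_span_X_image.1 hh b hb
      have h1 := ih hg ha
      have h2 : b v ≤ ∑ v ∈ C, b v := Finset.single_le_sum (fun _ _ => Nat.zero_le _) hv
      simp only [Finsupp.add_apply, Finset.sum_add_distrib]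
      omega
    | add g _ h _ ihg ihh =>
      rcases Finset.mem_union.1 (MvPolynomial.support_add hm) with hm | hm
      exacts [ihg hm, ihh hm]

theorem exists_isMinVCover_subset {D : Finset (Fin n)} (hD : IsVCover G D) :
    ∃ C ⊆ D, IsMinVCover G C := by
  induction D using Finset.strongInduction with
  | H D ih =>
    by_cases h : ∃ E, E ⊂ D ∧ IsVCover G E
    · obtain ⟨E, hED, hE⟩ := h
      obtain ⟨C, hCE, hC⟩ := ih E hED hE
      exact ⟨C, hCE.trans hED.subset, hC⟩
    · push Not at h
      exact ⟨D, subset_rfl, hD, h⟩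

theorem mem_symbolicPower {i : ℕ} {f : MvPolynomial (Fin n) k} :
    f ∈ symbolicPower k G i ↔ ∀ C : Finset (Fin n), IsMinVCover G C →
      f ∈ Ideal.span (MvPolynomial.X '' (C : Set (Fin n))) ^ i := by
  simp [symbolicPower]

theorem mul_mem_symbolicPower {i j : ℕ} {f g : MvPolynomial (Fin n) k}
    (hf : f ∈ symbolicPower k G i) (hg : g ∈ symbolicPower k G j) :
    f * g ∈ symbolicPower k G (i + j) :=
  mem_symbolicPower.2 fun C hC => by
    rw [pow_add]
    exact Ideal.mul_mem_mul (mem_symbolicPower.1 hf C hC) (mem_symbolicPower.1 hg C hC)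

variable (k G) in
/-- The symbolic Rees algebra of the edge ideal of `G`, as a subalgebra of `R[t]`. -/
noncomputable def symbolicReesSubalgebra :
    Subalgebra k (Polynomial (MvPolynomial (Fin n) k)) where
  carrier := {f | ∀ i : ℕ, f.coeff i ∈ symbolicPower k G i}
  mul_mem' {f g} hf hg i := by
    rw [Polynomial.coeff_mul]
    refine Ideal.sum_mem _ fun p hp => ?_
    rw [← Finset.HasAntidiagonal.mem_antidiagonal.1 hp]
    exact mul_mem_symbolicPower (hf _) (hg _)
  add_mem' {f g} hf hg i := by
    rw [Polynomial.coeff_add]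
    exact Ideal.add_mem _ (hf i) (hg i)
  algebraMap_mem' c i := by
    rw [Polynomial.algebraMap_apply, Polynomial.coeff_C]
    split_ifs with hi
    · subst hi
      exact mem_symbolicPower.2 fun C _ => by simp
    · exact zero_mem _

variable (k G) in
/-- The monomials `x^a t^r` with `x^a` square-free and supported on a clique with `r + 1`
vertices. -/
def cliqueMonomials : Set (Polynomial (MvPolynomial (Fin n) k)) :=
  { f | ∃ (K : Finset (Fin n)) (r : ℕ), G.IsClique (K : Set (Fin n)) ∧
      K.card = r + 1 ∧ r < n ∧
      f = Polynomial.monomial r (∏ i ∈ K, MvPolynomial.X i) }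

theorem IsVCover.card_le_card_inter_add_one {C K : Finset (Fin n)} (hC : IsVCover G C)
    (hK : G.IsClique (K : Set (Fin n))) : #K ≤ #(K ∩ C) + 1 := by
  have h : #(K \ C) ≤ 1 := by
    refine Finset.card_le_one.2 fun a ha b hb => ?_
    rw [Finset.mem_sdiff] at ha hb
    by_contra hab
    rcases hC (hK ha.1 hb.1 hab) with h | h
    exacts [ha.2 h, hb.2 h]
  have := Finset.card_inter_add_card_sdiff K C
  omega

theorem prod_X_mem_symbolicPower {K : Finset (Fin n)} {r : ℕ} (hK : G.IsClique (K : Set (Fin n)))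
    (hr : #K = r + 1) :
    ∏ i ∈ K, (MvPolynomial.X i : MvPolynomial (Fin n) k) ∈ symbolicPower k G r := by
  refine mem_symbolicPower.2 fun C hC => ?_
  have hle : r ≤ #(K ∩ C) := by
    have := hC.1.card_le_card_inter_add_one hK
    omega
  rw [← Finset.prod_inter_mul_prod_sdiff K C]
  refine Ideal.mul_mem_right _ _ (Ideal.pow_le_pow_right hle ?_)
  rw [← Finset.prod_const]
  exact Ideal.prod_mem_prod fun v hv =>
    Ideal.subset_span ⟨v, (Finset.mem_inter.1 hv).2, rfl⟩

theorem adjoin_cliqueMonomials_le :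
    Algebra.adjoin k (cliqueMonomials k G) ≤ symbolicReesSubalgebra k G := by
  refine Algebra.adjoin_le ?_
  rintro _ ⟨K, r, hK, hKr, -, rfl⟩ i
  rw [Polynomial.coeff_monomial]
  split_ifs with h
  · subst h
    exact prod_X_mem_symbolicPower hK hKr
  · exact zero_mem _

theorem monomial_prod_X_mem_adjoin_of_card {K : Finset (Fin n)}
    (hK : G.IsClique (K : Set (Fin n))) {r : ℕ} (hr : #K = r + 1) :
    Polynomial.monomial r (∏ i ∈ K, MvPolynomial.X i) ∈
      Algebra.adjoin k (cliqueMonomials k G) := by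
  have := Finset.card_le_univ K
  rw [Fintype.card_fin] at this
  exact Algebra.subset_adjoin ⟨K, r, hK, hr, by omega, rfl⟩

theorem monomial_zero_prod_X_mem_adjoin (K : Finset (Fin n)) :
    Polynomial.monomial 0 (∏ i ∈ K, MvPolynomial.X i) ∈
      Algebra.adjoin k (cliqueMonomials k G) := by
  rw [Polynomial.monomial_zero_left, map_prod]
  refine Subalgebra.prod_mem _ fun v _ => ?_
  have := monomial_prod_X_mem_adjoin_of_card (k := k) (G := G) (K := {v}) (r := 0) (by simp) rfl
  rwa [Finset.prod_singleton, Polynomial.monomial_zero_left] at this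

theorem monomial_prod_X_mem_adjoin {K : Finset (Fin n)} (hK : G.IsClique (K : Set (Fin n)))
    {j : ℕ} (hj : j ≤ #K - 1) :
    Polynomial.monomial j (∏ i ∈ K, MvPolynomial.X i) ∈
      Algebra.adjoin k (cliqueMonomials k G) := by
  rcases Nat.eq_zero_or_pos j with rfl | hj0
  · exact monomial_zero_prod_X_mem_adjoin K
  · obtain ⟨L, hLK, hL⟩ := Finset.exists_subset_card_eq (show j + 1 ≤ #K by omega)
    rw [← Finset.prod_sdiff hLK, ← zero_add j, ← Polynomial.monomial_mul_monomial]
    exact mul_mem (monomial_zero_prod_X_mem_adjoin _)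
      (monomial_prod_X_mem_adjoin_of_card (hK.subset (Finset.coe_subset.2 hLK)) hL)

theorem monomial_multiset_prod_mem_adjoin {T : Multiset (Finset (Fin n))}
    (hT : ∀ K ∈ T, G.IsClique (K : Set (Fin n))) {j : ℕ}
    (hj : j ≤ (T.map fun K => #K - 1).sum) :
    Polynomial.monomial j (T.map fun K => ∏ i ∈ K, MvPolynomial.X i).prod ∈
      Algebra.adjoin k (cliqueMonomials k G) := by
  induction T using Multiset.induction generalizing j with
  | empty =>
    obtain rfl : j = 0 := by simpa using hj
    simp
  | cons K T ih =>
    rw [Multiset.map_cons, Multiset.sum_cons] at hj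
    rw [Multiset.map_cons, Multiset.prod_cons,
      show j = min j (#K - 1) + (j - min j (#K - 1)) by omega,
      ← Polynomial.monomial_mul_monomial]
    exact mul_mem (monomial_prod_X_mem_adjoin (hT K (Multiset.mem_cons_self K T)) (by omega))
      (ih (fun L hL => hT L (Multiset.mem_cons_of_mem hL)) (by omega))

theorem multiset_prod_prod_X (T : Multiset (Finset (Fin n))) :
    (T.map fun K => ∏ i ∈ K, (MvPolynomial.X i : MvPolynomial (Fin n) k)).prod =
      ∏ v, MvPolynomial.X v ^ T.countP (v ∈ ·) := by
  induction T using Multiset.induction with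
  | empty => simp
  | cons K T ih =>
    simp only [Multiset.map_cons, Multiset.prod_cons, ih, Multiset.countP_cons, pow_add,
      Finset.prod_mul_distrib]
    rw [mul_comm]
    congr 1
    simp [pow_ite]

theorem sum_card_le_sum_card_sub_one_add_card {V : Type*} (T : Multiset (Finset V)) :
    (T.map fun K => #K).sum ≤ (T.map fun K => #K - 1).sum + Multiset.card T := by
  induction T using Multiset.induction with
  | empty => simp
  | cons K T ih =>
    simp only [Multiset.map_cons, Multiset.sum_cons, Multiset.card_cons]
    omega

theorem IsPerfect.monomial_mem_adjoin (hG : IsPerfect G) {a : Fin n →₀ ℕ} {i : ℕ}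
    (ha : ∀ C : Finset (Fin n), IsMinVCover G C → i ≤ ∑ v ∈ C, a v) (c : k) :
    Polynomial.monomial i (MvPolynomial.monomial a c) ∈
      Algebra.adjoin k (cliqueMonomials k G) := by
  have hcover : ∀ D : Finset (Fin n), IsVCover G D → i ≤ ∑ v ∈ D, a v := by
    intro D hD
    obtain ⟨C, hCD, hC⟩ := exists_isMinVCover_subset hD
    exact (ha C hC).trans (Finset.sum_le_sum_of_subset hCD)
  have hi := hcover Finset.univ fun u v _ => Or.inl (Finset.mem_univ u)
  obtain ⟨T, hTm, hT, hTa⟩ := hG.exists_cliques a (∑ v, a v - i) fun S hS => by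
    have h1 := hcover Sᶜ fun u v huv => by
      by_contra! h
      simp only [Finset.mem_compl, not_not] at h
      exact hS h.1 h.2 huv.ne huv
    have h2 := Finset.sum_add_sum_compl S a
    omega
  have hcard := sum_mul_countP_mem T fun _ => 1
  simp only [hTa, one_mul, ← Finset.card_eq_sum_ones] at hcard
  have hle := sum_card_le_sum_card_sub_one_add_card T
  have hmem := monomial_multiset_prod_mem_adjoin (k := k) hT (j := i) (by omega)
  rw [multiset_prod_prod_X] at hmem
  simp only [hTa] at hmem
  rw [← Finsupp.prod_fintype a (fun v e => (MvPolynomial.X v : MvPolynomial (Fin n) k) ^ e)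
    (by simp), Finsupp.prod, MvPolynomial.prod_X_pow_eq_monomial] at hmem
  have := Subalgebra.smul_mem _ hmem c
  rwa [Polynomial.smul_monomial, MvPolynomial.smul_monomial, smul_eq_mul, mul_one] at this

theorem IsPerfect.symbolicReesSubalgebra_le (hG : IsPerfect G) :
    symbolicReesSubalgebra k G ≤ Algebra.adjoin k (cliqueMonomials k G) := by
  intro f hf
  rw [f.as_sum_support]
  refine Subalgebra.sum_mem _ fun i _ => ?_
  rw [(f.coeff i).as_sum, map_sum]
  exact Subalgebra.sum_mem _ fun a ha => hG.monomial_mem_adjoin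
    (fun C hC => le_sum_of_mem_span_X_image_pow (mem_symbolicPower.1 (hf i) C hC) ha) _

end SymbolicReesAlgebra

/-- If `G` is a perfect graph with no isolated vertices,
then the symbolic Rees algebra of the edge ideal `I(G)`, i.e. the subset
`⊕_{i≥0} I(G)^{(i)} t^i = {f ∈ R[t] : coeff_i f ∈ I(G)^{(i)} for all i}` of
`R[t]`, equals the `K`-subalgebra of `R[t]` generated by the monomials
`x^a t^r` with `x^a` square-free and `supp(x^a)` a clique of `G` with `r+1`
vertices, `0 ≤ r < n`. -/
theorem symbolicReesAlgebra_eq_of_perfect {n : ℕ} (k : Type*) [Field k]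
    (G : SimpleGraph (Fin n))
    (hiso : ∀ v : Fin n, ∃ w : Fin n, G.Adj v w)
    (hperf : IsPerfect G) :
    (Algebra.adjoin k
      { f : Polynomial (MvPolynomial (Fin n) k) |
        ∃ (K : Finset (Fin n)) (r : ℕ), G.IsClique (K : Set (Fin n)) ∧
          K.card = r + 1 ∧ r < n ∧
          f = Polynomial.monomial r (∏ i ∈ K, MvPolynomial.X i) } :
        Set (Polynomial (MvPolynomial (Fin n) k))) =
    { f : Polynomial (MvPolynomial (Fin n) k) |
      ∀ i : ℕ, f.coeff i ∈ symbolicPower k G i } := by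
  exact congrArg SetLike.coe
    (adjoin_cliqueMonomials_le.antisymm hperf.symbolicReesSubalgebra_le)
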